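/- Assume a(i,i) = 2 for all i ∈ I. Let ν ∈ I^n be block-constant: ν_k = ν^i whenever c_{i−1} < k ≤ c_i, where ν^1,…,ν^p ∈ I satisfy ν^j ≠ ν^{j+1} for all 1 ≤ j < p. Let D(ν) := {d ∈ S_n : d is strictly increasing on each block {c_{i−1}+1,…,c_i} and dν = ν}, and for d ∈ D(ν) and c_{i−1} < k ≤ c_i define Ñ(d,ν,k) := N(d,ν,k) + (k − c_{i−1} − 1). Then Σ_{w ∈ S(ν,ν)} ∏_{t=1}^{n} N(w,ν,t) = (∏_{i=1}^{p} b_i!) · Σ_{d ∈ D(ν)} ∏_{t=1}^{n} Ñ(d,ν,t). (This is the combinatorial identity underlying Theorem 3.8 of the paper, the divided-power form of the dimension of e(ν)R^Λ(β)e(ν).) -/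

import Mathlib

/-- `N(w,ν,t) = L(ν_t) − Σ_{j ∈ J_w^{<t}} a(ν_t, ν_j)`, where
`J_w^{<t} = {j < t : w(j) < w(t)}`. -/
def Nfun {I : Type*} (a : I → I → ℤ) (L : I → ℤ) {n : ℕ}
    (w : Equiv.Perm (Fin n)) (ν : Fin n → I) (t : Fin n) : ℤ :=
  L (ν t) - ∑ j ∈ Finset.univ.filter (fun j => j < t ∧ w j < w t), a (ν t) (ν j)

open Finset in
/-- number of earlier elements of the same block -/
def cntB {n : ℕ} (f : Fin n → ℕ) (s : Fin n) : ℕ :=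
  (univ.filter (fun r : Fin n => r < s ∧ f r = f s)).card

open Finset in
/-- blockwise Lehmer code -/
def codeB {n : ℕ} (f : Fin n → ℕ) (v : Equiv.Perm (Fin n)) (s : Fin n) : ℕ :=
  (univ.filter (fun r : Fin n => r < s ∧ f r = f s ∧ v r < v s)).card

/-- blockwise permutations -/
def YB {n : ℕ} (f : Fin n → ℕ) : Finset (Equiv.Perm (Fin n)) :=
  Finset.univ.filter (fun v => ∀ k, f (v k) = f k)

open Finset in
lemma codeB_eq {n : ℕ} (f : Fin n → ℕ) (v : Equiv.Perm (Fin n)) (hv : ∀ k, f (v k) = f k)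
    (s : Fin n) :
    codeB f v s = (univ.filter (fun y : Fin n => ¬ (s < v.symm y) ∧ f y = f s ∧ y < v s)).card := by
  unfold codeB
  refine card_bij (fun r _ => v r) ?_ (fun _ _ _ _ h => v.injective h) ?_
  · intro r hr
    simp only [mem_filter, mem_univ, true_and] at hr ⊢
    rw [hv, Equiv.symm_apply_apply]
    exact ⟨not_lt.2 hr.1.le, hr.2.1, hr.2.2⟩
  · intro y hy
    simp only [mem_filter, mem_univ, true_and] at hy
    refine ⟨v.symm y, ?_, by simp⟩
    simp only [mem_filter, mem_univ, true_and, Equiv.apply_symm_apply]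
    refine ⟨lt_of_le_of_ne (not_lt.1 hy.1) ?_, ?_, hy.2.2⟩
    · rintro rfl
      simp at hy
    · rw [← hy.2.1, ← hv (v.symm y), Equiv.apply_symm_apply]

open Finset in
lemma codeB_step {n : ℕ} (f : Fin n → ℕ) (v v' : Equiv.Perm (Fin n)) (hv : ∀ k, f (v k) = f k)
    (hv' : ∀ k, f (v' k) = f k) (s : Fin n) (ih : ∀ r, s < r → v r = v' r)
    (h : codeB f v s = codeB f v' s) : ¬ v s < v' s := by
  intro hlt
  rw [codeB_eq f v hv, codeB_eq f v' hv'] at h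
  refine absurd h (ne_of_lt (card_lt_card ?_))
  have key : ∀ y, s < v'.symm y → s < v.symm y := by
    intro y hy
    have : v (v'.symm y) = y := by rw [ih _ hy]; simp
    rw [← this]; simpa using hy
  have key2 : ∀ y, s < v.symm y → s < v'.symm y := by
    intro y hy
    have : v' (v.symm y) = y := by rw [← ih _ hy]; simp
    rw [← this]; simpa using hy
  rw [ssubset_iff_of_subset]
  · refine ⟨v s, ?_, by simp⟩
    simp only [mem_filter, mem_univ, true_and]
    refine ⟨fun hh => ?_, hv s, hlt⟩
    have := key _ hh
    simp at this
  · intro y hy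
    simp only [mem_filter, mem_univ, true_and] at hy ⊢
    exact ⟨fun hh => hy.1 (key _ hh), hy.2.1, hy.2.2.trans hlt⟩

lemma codeB_inj {n : ℕ} (f : Fin n → ℕ) (v v' : Equiv.Perm (Fin n)) (hv : ∀ k, f (v k) = f k)
    (hv' : ∀ k, f (v' k) = f k) (h : codeB f v = codeB f v') : v = v' := by
  have : ∀ m : ℕ, ∀ s : Fin n, n - (s : ℕ) = m → v s = v' s := by
    intro m
    induction m using Nat.strong_induction_on with
    | _ m ih =>
      intro s hs
      have ih' : ∀ r, s < r → v r = v' r := by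
        intro r hr
        exact ih (n - r) (by have := r.2; have : (s : ℕ) < r := hr; omega) r rfl
      have h1 := codeB_step f v v' hv hv' s ih' (congrFun h s)
      have h2 := codeB_step f v' v hv' hv s (fun r hr => (ih' r hr).symm) (congrFun h s).symm
      exact le_antisymm (not_lt.1 h2) (not_lt.1 h1)
  exact Equiv.ext fun s => this _ s rfl

open Finset in
lemma sum_YB {n : ℕ} (f : Fin n → ℕ) (hcard : (YB f).card = ∏ s, (cntB f s + 1))
    (g : Fin n → ℕ → ℤ) :
    ∑ v ∈ YB f, ∏ s, g s (codeB f v s) = ∏ s, ∑ k ∈ range (cntB f s + 1), g s k := by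
  rw [prod_univ_sum]
  have hinj : Set.InjOn (codeB f) (YB f : Set (Equiv.Perm (Fin n))) := by
    intro v hv v' hv' h
    simp only [YB, coe_filter, mem_univ, true_and, Set.mem_ofPred_eq] at hv hv'
    exact codeB_inj f v v' hv hv' h
  have himg : (YB f).image (codeB f) = Fintype.piFinset (fun s => range (cntB f s + 1)) := by
    apply eq_of_subset_of_card_le
    · intro x hx
      obtain ⟨v, -, rfl⟩ := mem_image.1 hx
      rw [Fintype.mem_piFinset]
      intro s
      rw [mem_range, Nat.lt_succ_iff]
      apply card_le_card
      intro r
      simp only [mem_filter]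
      tauto
    · rw [card_image_of_injOn hinj, hcard, Fintype.card_piFinset]
      simp
  rw [← himg, sum_image hinj]

lemma sum_lin (M : ℤ) (c : ℕ) :
    ∑ k ∈ Finset.range (c + 1), (M - 2 * (k : ℤ)) = ((c + 1 : ℕ) : ℤ) * (M - c) := by
  induction c with
  | zero => simp
  | succ c ih => rw [Finset.sum_range_succ, ih]; push_cast; ring

open Finset in
/-- contribution of the other blocks -/
def MB {I : Type*} (a : I → I → ℤ) (L : I → ℤ) {n : ℕ} (f : Fin n → ℕ)
    (d : Equiv.Perm (Fin n)) (ν : Fin n → I) (s : Fin n) : ℤ :=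
  L (ν s) - ∑ r ∈ univ.filter (fun r => (r < s ∧ d r < d s) ∧ f r ≠ f s), a (ν s) (ν r)

open Finset in
lemma Nfun_eq {I : Type*} (a : I → I → ℤ) (L : I → ℤ) (ha : ∀ i, a i i = 2) {n : ℕ}
    (f : Fin n → ℕ) (hf : Monotone f) (nb : ℕ → I) (ν : Fin n → I) (hν : ∀ k, ν k = nb (f k))
    (d v : Equiv.Perm (Fin n)) (hd : ∀ k l, k < l → f k = f l → d k < d l)
    (hv : ∀ k, f (v k) = f k) (s : Fin n) :
    Nfun a L (d * v⁻¹) ν (v s) = MB a L f d ν s - 2 * (codeB f v s : ℤ) := by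
  have hνv : ∀ k, ν (v k) = ν k := fun k => by rw [hν, hν, hv]
  unfold Nfun MB codeB
  have e1 : ∑ j ∈ univ.filter (fun j => j < v s ∧ (d * v⁻¹) j < (d * v⁻¹) (v s)),
      a (ν (v s)) (ν j) = ∑ r ∈ univ.filter (fun r => v r < v s ∧ d r < d s), a (ν s) (ν r) := by
    rw [sum_filter, sum_filter, ← Equiv.sum_comp v]
    simp [hνv]
  have hlt : ∀ x y, f x < f y → x < y := fun x y h => by
    by_contra hh
    exact absurd (hf (not_lt.1 hh)) (not_le.2 h)
  have hlt2 : ∀ x y, x < y → f x ≠ f y → f x < f y := fun x y h h' =>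
    lt_of_le_of_ne (hf h.le) h'
  rw [e1, ← sum_filter_add_sum_filter_not (univ.filter (fun r => v r < v s ∧ d r < d s))
    (fun r => f r ≠ f s), filter_filter, filter_filter]
  have e2 : univ.filter (fun r => (v r < v s ∧ d r < d s) ∧ f r ≠ f s) =
      univ.filter (fun r => (r < s ∧ d r < d s) ∧ f r ≠ f s) := by
    ext r
    simp only [mem_filter, mem_univ, true_and]
    constructor
    · rintro ⟨⟨h1, h2⟩, h3⟩
      refine ⟨⟨hlt _ _ ?_, h2⟩, h3⟩
      have := hlt2 _ _ h1 (by rwa [hv, hv])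
      rwa [hv, hv] at this
    · rintro ⟨⟨h1, h2⟩, h3⟩
      refine ⟨⟨hlt _ _ ?_, h2⟩, h3⟩
      rw [hv, hv]; exact hlt2 _ _ h1 h3
  have e3 : univ.filter (fun r => (v r < v s ∧ d r < d s) ∧ ¬ f r ≠ f s) =
      univ.filter (fun r => r < s ∧ f r = f s ∧ v r < v s) := by
    ext r
    simp only [mem_filter, mem_univ, true_and, not_not]
    constructor
    · rintro ⟨⟨h1, h2⟩, h3⟩
      refine ⟨?_, h3, h1⟩
      by_contra hh
      rcases (not_lt.1 hh).lt_or_eq with h | h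
      · exact lt_asymm h2 (hd _ _ h h3.symm)
      · subst h; exact lt_irrefl _ h1
    · rintro ⟨h1, h2, h3⟩
      exact ⟨⟨h3, hd _ _ h1 h2⟩, h2⟩
  have e4 : ∑ r ∈ univ.filter (fun r => r < s ∧ f r = f s ∧ v r < v s), a (ν s) (ν r) =
      ∑ r ∈ univ.filter (fun r => r < s ∧ f r = f s ∧ v r < v s), 2 := by
    refine sum_congr rfl fun r hr => ?_
    simp only [mem_filter, mem_univ, true_and] at hr
    rw [hν, hν, hr.2.1, ha]
  rw [e2, e3, e4, hνv, sum_const]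
  simp only [nsmul_eq_mul]
  ring

lemma codeB_one {n : ℕ} (f : Fin n → ℕ) (s : Fin n) : codeB f 1 s = cntB f s := by
  unfold codeB cntB
  congr 1
  ext r
  rw [Finset.mem_filter, Finset.mem_filter]
  simp only [Equiv.Perm.one_apply]
  tauto

lemma lex_mono {n : ℕ} (f : Fin n → ℕ) (hf : Monotone f) (d : Fin n → Fin n)
    (hd : ∀ k l, k < l → f k = f l → d k < d l) :
    Monotone (fun k => toLex (f k, d k)) := by
  intro k l hkl
  rcases hkl.lt_or_eq with h | rfl
  · rw [Prod.Lex.toLex_le_toLex]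
    rcases (hf hkl).lt_or_eq with h' | h'
    · exact Or.inl h'
    · exact Or.inr ⟨h', (hd _ _ h h').le⟩
  · exact le_rfl

lemma exists_sort {n : ℕ} (f : Fin n → ℕ) (hf : Monotone f) (w : Equiv.Perm (Fin n)) :
    ∃ v : Equiv.Perm (Fin n), (∀ k, f (v k) = f k) ∧
      ∀ k l, k < l → f k = f l → (w * v) k < (w * v) l := by
  let σ := Tuple.sort (fun k => toLex (f k, w k))
  have hm := Tuple.monotone_sort (fun k => toLex (f k, w k))
  have hm1 : Monotone (f ∘ σ) := by
    intro k l h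
    have := hm h
    simp only [Function.comp, Prod.Lex.toLex_le_toLex] at this
    rcases this with h | h
    · exact le_of_lt h
    · exact le_of_eq h.1
  have hfs : f ∘ σ = f ∘ (1 : Equiv.Perm (Fin n)) := Tuple.unique_monotone hm1 (by simpa using hf)
  have hfs' : ∀ k, f (σ k) = f k := fun k => congrFun hfs k
  refine ⟨σ, hfs', fun k l hkl hf' => ?_⟩
  have := hm hkl.le
  simp only [Function.comp, Prod.Lex.toLex_le_toLex] at this
  rcases this with h | h
  · have h : f (σ k) < f (σ l) := h
    rw [hfs', hfs'] at h; omega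
  · refine lt_of_le_of_ne h.2 fun h => ?_
    exact hkl.ne ((w * σ).injective h)

lemma uniq_sort {n : ℕ} (f : Fin n → ℕ) (hf : Monotone f) (d u : Equiv.Perm (Fin n))
    (hd : ∀ k l, k < l → f k = f l → d k < d l) (hu : ∀ k, f (u k) = f k)
    (hdu : ∀ k l, k < l → f k = f l → (d * u) k < (d * u) l) : u = 1 := by
  have h1 := lex_mono f hf d hd
  have h2 : Monotone ((fun k => toLex (f k, d k)) ∘ u) := by
    have := lex_mono f hf (fun k => d (u k)) hdu
    simpa [Function.comp_def, hu] using this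
  have h3 := Tuple.unique_monotone (τ := 1) h2 (by simpa using h1)
  ext k
  have := congrFun h3 k
  simp only [Function.comp, EmbeddingLike.apply_eq_iff_eq, Prod.mk.injEq] at this
  simp [this.2]

open Finset in
lemma main_aux {I : Type*} [DecidableEq I] (a : I → I → ℤ) (L : I → ℤ) (ha : ∀ i, a i i = 2) {n : ℕ}
    (f : Fin n → ℕ) (hf : Monotone f) (nb : ℕ → I) (ν : Fin n → I) (hν : ∀ k, ν k = nb (f k))
    (hcard : (YB f).card = ∏ s, (cntB f s + 1)) :
    ∑ w ∈ Finset.univ.filter (fun w : Equiv.Perm (Fin n) => ∀ k, ν (w⁻¹ k) = ν k),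
        ∏ t : Fin n, Nfun a L w ν t
      = (∏ s, ((cntB f s + 1 : ℕ) : ℤ)) *
        ∑ d ∈ Finset.univ.filter (fun d : Equiv.Perm (Fin n) =>
            (∀ k l, k < l → f k = f l → d k < d l)
            ∧ ∀ k, ν (d⁻¹ k) = ν k),
          ∏ t : Fin n, (Nfun a L d ν t + cntB f t) := by
  have hνv : ∀ v : Equiv.Perm (Fin n), (∀ k, f (v k) = f k) → ∀ k, ν (v k) = ν k :=
    fun v hv k => by rw [hν, hν, hv]
  set D := Finset.univ.filter (fun d : Equiv.Perm (Fin n) =>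
            (∀ k l, k < l → f k = f l → d k < d l) ∧ ∀ k, ν (d⁻¹ k) = ν k) with hD
  have step1 : ∑ w ∈ Finset.univ.filter (fun w : Equiv.Perm (Fin n) => ∀ k, ν (w⁻¹ k) = ν k),
        ∏ t : Fin n, Nfun a L w ν t =
      ∑ x ∈ D ×ˢ YB f, ∏ t : Fin n, Nfun a L (x.1 * x.2⁻¹) ν t := by
    symm
    refine sum_bij (fun x _ => x.1 * x.2⁻¹) ?_ ?_ ?_ (fun _ _ => rfl)
    · rintro ⟨d, v⟩ hx
      simp only [hD, YB, mem_product, mem_filter, mem_univ, true_and] at hx ⊢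
      intro k
      rw [mul_inv_rev, inv_inv, Equiv.Perm.mul_apply, hνv v hx.2, hx.1.2]
    · rintro ⟨d, v⟩ hx ⟨d', v'⟩ hx' h
      simp only [hD, YB, mem_product, mem_filter, mem_univ, true_and] at hx hx' h
      have hd' : d' = d * (v⁻¹ * v') := by
        rw [← mul_assoc, h]; group
      have hu : v⁻¹ * v' = 1 := by
        refine uniq_sort f hf d _ hx.1.1 ?_ (hd' ▸ hx'.1.1)
        intro k
        rw [Equiv.Perm.mul_apply, ← hx.2, show v (v⁻¹ (v' k)) = v' k from v.apply_symm_apply _, hx'.2]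
      rw [hu, mul_one] at hd'
      rw [hd', inv_mul_eq_one.1 hu]
    · intro w hw
      simp only [mem_filter, mem_univ, true_and] at hw
      obtain ⟨v, hv, hwv⟩ := exists_sort f hf w
      refine ⟨(w * v, v), ?_, by simp⟩
      simp only [hD, YB, mem_product, mem_filter, mem_univ, true_and]
      refine ⟨⟨hwv, fun k => ?_⟩, hv⟩
      rw [mul_inv_rev, Equiv.Perm.mul_apply, ← hνv v hv, show v (v⁻¹ (w⁻¹ k)) = w⁻¹ k from v.apply_symm_apply _, hw]
  rw [step1, sum_product, mul_sum]
  refine sum_congr rfl fun d hd => ?_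
  simp only [hD, mem_filter, mem_univ, true_and] at hd
  have e : ∀ v ∈ YB f, ∏ t : Fin n, Nfun a L (d * v⁻¹) ν t =
      ∏ s, (fun s (k : ℕ) => MB a L f d ν s - 2 * (k : ℤ)) s (codeB f v s) := by
    intro v hv
    simp only [YB, mem_filter, mem_univ, true_and] at hv
    rw [← Equiv.prod_comp v]
    exact prod_congr rfl fun s _ => Nfun_eq a L ha f hf nb ν hν d v hd.1 hv s
  rw [sum_congr rfl e, sum_YB f hcard (fun s (k : ℕ) => MB a L f d ν s - 2 * (k : ℤ)), ← prod_mul_distrib]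
  refine prod_congr rfl fun s _ => ?_
  have := Nfun_eq a L ha f hf nb ν hν d 1 hd.1 (fun _ => rfl) s
  rw [codeB_one] at this
  simp only [inv_one, mul_one, Equiv.Perm.one_apply] at this
  rw [sum_lin, this]
  ring

lemma card_YB {n : ℕ} (f : Fin n → ℕ) (p : ℕ) (hfp : ∀ k, f k < p) :
    (YB f).card = ∏ i ∈ Finset.range p,
      ((Finset.univ.filter (fun k => f k = i)).card).factorial := by
  have h := DomMulAct.stabilizer_card' f
  have e : (YB f).card = Fintype.card {g : Equiv.Perm (Fin n) // f ∘ g = f} := by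
    rw [Fintype.card_subtype]
    unfold YB
    congr 1
    ext v
    simp [funext_iff]
  rw [e, h]
  simp only [Fintype.card_subtype]
  refine Finset.prod_subset ?_ ?_
  · intro i hi
    obtain ⟨k, -, rfl⟩ := Finset.mem_image.1 hi
    exact Finset.mem_range.2 (hfp k)
  · intro i _ hi
    have : (Finset.univ.filter (fun k => f k = i)) = ∅ := by
      ext k
      simp only [Finset.mem_filter, Finset.mem_univ, true_and, Finset.notMem_empty, iff_false]
      rintro rfl
      exact hi (Finset.mem_image_of_mem _ (Finset.mem_univ _))
    simp [this]

/-- Theorem 3.8 of the paper (combinatorial form): for block-constant `ν` with adjacent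
block values distinct, `Σ_{w ∈ S(ν,ν)} ∏_t N(w,ν,t) = (∏_i b_i!) · Σ_{d ∈ D(ν)} ∏_t Ñ(d,ν,t)`,
where `Ñ(d,ν,k) = N(d,ν,k) + (k − c_i)` (0-based) for `k` in block `i`, and `D(ν)` consists
of the permutations strictly increasing on each block with `dν = ν`. -/
theorem stmt4 {I : Type*} [DecidableEq I] (a : I → I → ℤ) (L : I → ℤ)
    (ha : ∀ i, a i i = 2)
    (n p : ℕ) (hp : 1 ≤ p)
    (b : ℕ → ℕ) (hbpos : ∀ i < p, 0 < b i)
    (c : ℕ → ℕ) (hc : ∀ i, c i = ∑ j ∈ Finset.range i, b j) (hcp : c p = n)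
    (nb : ℕ → I) (hadj : ∀ i, i + 1 < p → nb i ≠ nb (i + 1))
    (ν : Fin n → I)
    (hν : ∀ i < p, ∀ k : Fin n, c i ≤ (k : ℕ) → (k : ℕ) < c (i + 1) → ν k = nb i)
    (Ntil : Equiv.Perm (Fin n) → Fin n → ℤ)
    (hNtil : ∀ d : Equiv.Perm (Fin n), ∀ i < p, ∀ k : Fin n,
      c i ≤ (k : ℕ) → (k : ℕ) < c (i + 1) →
      Ntil d k = Nfun a L d ν k + (((k : ℕ) : ℤ) - (c i : ℤ))) :
    ∑ w ∈ Finset.univ.filter (fun w : Equiv.Perm (Fin n) => ∀ k, ν (w⁻¹ k) = ν k),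
        ∏ t : Fin n, Nfun a L w ν t
      = (∏ i ∈ Finset.range p, ((b i).factorial : ℤ)) *
        ∑ d ∈ Finset.univ.filter (fun d : Equiv.Perm (Fin n) =>
            (∀ i < p, ∀ k l : Fin n,
              c i ≤ (k : ℕ) → k < l → (l : ℕ) < c (i + 1) → d k < d l)
            ∧ ∀ k, ν (d⁻¹ k) = ν k),
          ∏ t : Fin n, Ntil d t := by
  have hcs : ∀ i, c (i + 1) = c i + b i := fun i => by rw [hc, hc, Finset.sum_range_succ]
  have hcm : Monotone c := monotone_nat_of_le_succ fun i => by rw [hcs]; omega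
  have hex : ∀ k : Fin n, ∃ i, i < p ∧ c i ≤ (k : ℕ) ∧ (k : ℕ) < c (i + 1) := by
    intro k
    have h0 : c 0 = 0 := by simp [hc]
    have hP : ∃ i, (k : ℕ) < c (i + 1) := ⟨p - 1, by
      rw [Nat.sub_add_cancel hp, hcp]; exact k.2⟩
    refine ⟨Nat.find hP, ?_, ?_, Nat.find_spec hP⟩
    · have : Nat.find hP ≤ p - 1 := Nat.find_min' hP (by
        rw [Nat.sub_add_cancel hp, hcp]; exact k.2)
      omega
    · rcases hq : Nat.find hP with _ | m
      · omega
      · have := Nat.find_min hP (m := m) (by omega)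
        omega
  choose f hfp hf1 hf2 using hex
  have huniq : ∀ k : Fin n, ∀ i, c i ≤ (k : ℕ) → (k : ℕ) < c (i + 1) → f k = i := by
    intro k i h1 h2
    have a1 := hf1 k
    have a2 := hf2 k
    rcases lt_trichotomy (f k) i with h | h | h
    · have := hcm (show f k + 1 ≤ i from h); omega
    · exact h
    · have := hcm (show i + 1 ≤ f k from h); omega
  have hfm : Monotone f := by
    intro k l hkl
    by_contra hh
    have a1 := hf1 k
    have a2 := hf2 l
    have := hcm (show f l + 1 ≤ f k by omega)
    have : (k : ℕ) ≤ l := hkl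
    omega
  have hν' : ∀ k, ν k = nb (f k) := fun k => hν _ (hfp k) k (hf1 k) (hf2 k)
  have hcnt : ∀ s : Fin n, cntB f s = (s : ℕ) - c (f s) := by
    intro s
    unfold cntB
    rw [← Nat.card_Ico, ← Finset.card_map Fin.valEmbedding]
    congr 1
    ext x
    simp only [Finset.mem_map, Finset.mem_filter, Finset.mem_univ, true_and,
      Fin.valEmbedding_apply, Finset.mem_Ico]
    constructor
    · rintro ⟨r, ⟨h1, h2⟩, rfl⟩
      exact ⟨h2 ▸ hf1 r, h1⟩
    · rintro ⟨h1, h2⟩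
      exact ⟨⟨x, h2.trans s.2⟩, ⟨h2, huniq _ _ h1 (h2.trans (hf2 s))⟩, rfl⟩
  have hfib : ∀ i < p, (Finset.univ.filter (fun k => f k = i)).map Fin.valEmbedding
      = Finset.Ico (c i) (c (i + 1)) := by
    intro i hi
    ext x
    simp only [Finset.mem_map, Finset.mem_filter, Finset.mem_univ, true_and,
      Fin.valEmbedding_apply, Finset.mem_Ico]
    constructor
    · rintro ⟨r, rfl, rfl⟩
      exact ⟨hf1 r, hf2 r⟩
    · rintro ⟨h1, h2⟩
      have := hcm (show i + 1 ≤ p from hi)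
      exact ⟨⟨x, by omega⟩, huniq _ _ h1 h2, rfl⟩
  have hprod : ∏ s, (cntB f s + 1) = ∏ i ∈ Finset.range p, (b i).factorial := by
    rw [← Finset.prod_fiberwise_of_maps_to (g := f) (t := Finset.range p)
      (fun k _ => Finset.mem_range.2 (hfp k))]
    refine Finset.prod_congr rfl fun i hi => ?_
    have e : ∏ s ∈ Finset.univ.filter (fun k => f k = i), (cntB f s + 1)
        = ∏ x ∈ (Finset.univ.filter (fun k => f k = i)).map Fin.valEmbedding, (x - c i + 1) := by
      rw [Finset.prod_map]
      refine Finset.prod_congr rfl fun s hs => ?_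
      rw [hcnt, (Finset.mem_filter.1 hs).2]
      rfl
    rw [e, hfib i (Finset.mem_range.1 hi), Finset.prod_Ico_eq_prod_range, hcs,
      ← Finset.prod_range_add_one_eq_factorial]
    simp
  have hcard : (YB f).card = ∏ s, (cntB f s + 1) := by
    rw [hprod, card_YB f p hfp]
    refine Finset.prod_congr rfl fun i hi => ?_
    rw [← Finset.card_map Fin.valEmbedding, hfib i (Finset.mem_range.1 hi), Nat.card_Ico, hcs]
    simp
  rw [main_aux a L ha f hfm nb ν hν' hcard, ← Nat.cast_prod, hprod, Nat.cast_prod]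
  congr 1
  refine Finset.sum_congr ?_ fun d _ => Finset.prod_congr rfl fun t _ => ?_
  · ext d
    simp only [Finset.mem_filter, Finset.mem_univ, true_and]
    refine and_congr_left fun _ => ⟨fun h i _ k l h1 h2 h3 => ?_, fun h k l h1 h2 => ?_⟩
    · have : (k : ℕ) < l := h2
      refine h k l h2 ?_
      rw [huniq k i h1 (by omega), huniq l i (by omega) h3]
    · exact h (f k) (hfp k) k l (hf1 k) h1 (h2 ▸ hf2 l)
  · rw [hNtil d _ (hfp t) t (hf1 t) (hf2 t), hcnt, Nat.cast_sub (hf1 t)]
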